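/- arXiv:math/0311532 — 10 statements merged into one kernel-verified Lean document; each statement's English description precedes it below -/
import Mathlib

section
/- Let z(k) = 1/2 - 1/(k(k+3)) for integers k ≥ 1. Then z(1) = 1/4, z(k) ≠ 1 for all k, the sequence satisfies z(1) = (1/12)·(1/(1-z(1)) + 1/(1-z(2))) and, for every k ≥ 2, z(k) = (1/12)·(1/(1-z(k-1)) + 1/(1-z(k)) + 1/(1-z(k+1))). Moreover it is the unique such sequence: if (z'(k))_{k≥1} is any real sequence with z'(1) = 1/4, z'(k) ≠ 1 for all k ≥ 1, and satisfying the same two relations, then z'(k) = z(k) for all k ≥ 1. -/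
/-- `zseq k = Z^{(k)}(1/12)`, the value of the generating function of k-labeled
trees with first root vertex of degree 1 at the critical point 1/12. -/
noncomputable def zseq (k : ℕ) : ℝ := 1 / 2 - 1 / ((k : ℝ) * (k + 3))

theorem one_div_one_sub_zseq {k : ℕ} (hk : 1 ≤ k) :
    1 / (1 - zseq k) = 2 * k * (k + 3) / (((k : ℝ) + 1) * (k + 2)) := by
  have hk' : (0 : ℝ) < k := by exact_mod_cast hk
  have h : 1 - zseq k = ((k : ℝ) + 1) * (k + 2) / (2 * k * (k + 3)) := by
    unfold zseq
    field_simp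
    ring
  rw [h, one_div_div]

theorem zseq_lt_one (k : ℕ) : zseq k < 1 := by
  have h : (0 : ℝ) ≤ 1 / ((k : ℝ) * (k + 3)) := by positivity
  unfold zseq
  linarith

theorem zseq_one_eq :
    zseq 1 = (1 / 12) * (1 / (1 - zseq 1) + 1 / (1 - zseq 2)) := by
  norm_num [zseq]

theorem zseq_recurrence {k : ℕ} (hk : 2 ≤ k) :
    zseq k = (1 / 12) *
      (1 / (1 - zseq (k - 1)) + 1 / (1 - zseq k) + 1 / (1 - zseq (k + 1))) := by
  obtain ⟨n, rfl⟩ := Nat.exists_eq_add_of_le' hk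
  rw [show n + 2 - 1 = n + 1 by omega, one_div_one_sub_zseq (by omega),
    one_div_one_sub_zseq (by omega), one_div_one_sub_zseq (by omega)]
  unfold zseq
  push_cast
  field_simp
  ring

theorem eq_of_one_div_one_sub_eq {x y : ℝ} (h : 1 / (1 - x) = 1 / (1 - y)) : x = y := by
  rw [one_div, one_div, inv_inj] at h
  linarith

theorem stmt0 :
    zseq 1 = 1 / 4 ∧
    (∀ k : ℕ, 1 ≤ k → zseq k ≠ 1) ∧
    zseq 1 = (1 / 12) * (1 / (1 - zseq 1) + 1 / (1 - zseq 2)) ∧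
    (∀ k : ℕ, 2 ≤ k →
      zseq k = (1 / 12) *
        (1 / (1 - zseq (k - 1)) + 1 / (1 - zseq k) + 1 / (1 - zseq (k + 1)))) ∧
    (∀ z' : ℕ → ℝ, z' 1 = 1 / 4 → (∀ k : ℕ, 1 ≤ k → z' k ≠ 1) →
      z' 1 = (1 / 12) * (1 / (1 - z' 1) + 1 / (1 - z' 2)) →
      (∀ k : ℕ, 2 ≤ k →
        z' k = (1 / 12) *
          (1 / (1 - z' (k - 1)) + 1 / (1 - z' k) + 1 / (1 - z' (k + 1)))) →
      ∀ k : ℕ, 1 ≤ k → z' k = zseq k) := by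
  refine ⟨by norm_num [zseq], fun k _ => (zseq_lt_one k).ne, zseq_one_eq,
    fun k hk => zseq_recurrence hk, ?_⟩
  intro z' h1 _ h12 hrec
  have e1 : z' 1 = zseq 1 := by rw [h1]; norm_num [zseq]
  have e2 : z' 2 = zseq 2 := by
    apply eq_of_one_div_one_sub_eq
    have h := zseq_one_eq
    rw [e1] at h12
    linarith
  have key : ∀ n : ℕ, z' (n + 1) = zseq (n + 1) ∧ z' (n + 2) = zseq (n + 2) := by
    intro n
    induction n with
    | zero => exact ⟨e1, e2⟩
    | succ n ih =>
      refine ⟨ih.2, eq_of_one_div_one_sub_eq ?_⟩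
      have h := hrec (n + 2) (by omega)
      have hz := zseq_recurrence (k := n + 2) (by omega)
      rw [show n + 2 - 1 = n + 1 by omega] at h hz
      rw [ih.1, ih.2] at h
      rw [show n + 1 + 2 = n + 2 + 1 by omega]
      linarith
  intro k hk
  obtain ⟨n, rfl⟩ := Nat.exists_eq_add_of_le' hk
  exact (key n).1
end

section
/- Let w : ℕ → ℝ be defined by w(0) = 0 and w(k) = 2k(k+3)/((k+1)(k+2)) for k ≥ 1, and let d : ℕ → ℝ be defined by d(0) = 0 and d(k) = (3/280)·(k(k+3)/((k+1)(k+2)))·(5k⁴ + 30k³ + 59k² + 42k + 4) for k ≥ 1. Then d(1) = 1, d(1) + d(2) = 12·d(1)/w(1)², and d(k-1) + d(k) + d(k+1) = 12·d(k)/w(k)² for every k ≥ 2. Moreover d is the unique sequence with these properties: any real sequence (d'(k))_{k≥0} with d'(0) = 0, d'(1) = 1, d'(1) + d'(2) = 12·d'(1)/w(1)² and d'(k-1) + d'(k) + d'(k+1) = 12·d'(k)/w(k)² for all k ≥ 2 equals d. -/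
/-- `wseq k = W^{(k)}(1/12)`. Note `wseq 0 = 0`. -/
noncomputable def wseq (k : ℕ) : ℝ := 2 * k * (k + 3) / ((k + 1) * (k + 2))

/-- `dseq k` is the limit of `D_N^{(k)}/D_N` as `N → ∞`. Note `dseq 0 = 0`. -/
noncomputable def dseq (k : ℕ) : ℝ :=
  (3 / 280) * ((k : ℝ) * (k + 3) / ((k + 1) * (k + 2))) *
    (5 * (k : ℝ) ^ 4 + 30 * (k : ℝ) ^ 3 + 59 * (k : ℝ) ^ 2 + 42 * k + 4)

theorem dseq_zero : dseq 0 = 0 := by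
  simp [dseq]

theorem dseq_one : dseq 1 = 1 := by
  norm_num [dseq]

theorem dseq_recurrence (n : ℕ) :
    dseq n + dseq (n + 1) + dseq (n + 2) = 12 * dseq (n + 1) / (wseq (n + 1)) ^ 2 := by
  have h0 : (0 : ℝ) ≤ n := n.cast_nonneg
  have h1 : (n : ℝ) + 1 ≠ 0 := by positivity
  have h2 : (n : ℝ) + 2 ≠ 0 := by positivity
  have h3 : (n : ℝ) + 3 ≠ 0 := by positivity
  have h4 : (n : ℝ) + 4 ≠ 0 := by positivity
  have e2 : (n : ℝ) + 1 + 1 = n + 2 := by ring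
  have e3 : (n : ℝ) + 1 + 2 = n + 3 := by ring
  have e4 : (n : ℝ) + 1 + 3 = n + 4 := by ring
  have f3 : (n : ℝ) + 2 + 1 = n + 3 := by ring
  have f4 : (n : ℝ) + 2 + 2 = n + 4 := by ring
  simp only [dseq, wseq]
  push_cast
  rw [e2, e3, e4, f3, f4]
  field_simp
  ring

theorem stmt2 :
    dseq 1 = 1 ∧
    dseq 1 + dseq 2 = 12 * dseq 1 / (wseq 1) ^ 2 ∧
    (∀ k : ℕ, 2 ≤ k →
      dseq (k - 1) + dseq k + dseq (k + 1) = 12 * dseq k / (wseq k) ^ 2) ∧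
    (∀ d' : ℕ → ℝ, d' 0 = 0 → d' 1 = 1 →
      d' 1 + d' 2 = 12 * d' 1 / (wseq 1) ^ 2 →
      (∀ k : ℕ, 2 ≤ k →
        d' (k - 1) + d' k + d' (k + 1) = 12 * d' k / (wseq k) ^ 2) →
      ∀ k : ℕ, d' k = dseq k) := by
  refine ⟨dseq_one, ?_, ?_, ?_⟩
  · simpa [dseq_zero] using dseq_recurrence 0
  · intro k hk
    obtain ⟨n, rfl⟩ : ∃ n, k = n + 1 := ⟨k - 1, by omega⟩
    exact dseq_recurrence n
  · intro d' h0 h1 h2 hrec k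
    have hrec' (n : ℕ) :
        d' n + d' (n + 1) + d' (n + 2) = 12 * d' (n + 1) / (wseq (n + 1)) ^ 2 := by
      rcases n with _ | n
      · simpa [h0] using h2
      · exact hrec (n + 2) (by omega)
    induction k using Nat.twoStepInduction with
    | zero => rw [h0, dseq_zero]
    | one => rw [h1, dseq_one]
    | more n ih ih' =>
      have h := hrec' n
      rw [ih, ih', ← dseq_recurrence n] at h
      linarith
end

section
/- Let w : ℕ → ℝ be defined by w(0) = 0 and w(k) = 2k(k+3)/((k+1)(k+2)) for k ≥ 1, and let d : ℕ → ℝ be defined by d(0) = 0 and d(k) = (3/280)·(k(k+3)/((k+1)(k+2)))·(5k⁴ + 30k³ + 59k² + 42k + 4) for k ≥ 1. For k ≥ 1 set q(k) = w(k)²·d(k-1)/(12·d(k)), r(k) = w(k)²/12 and p(k) = w(k)²·d(k+1)/(12·d(k)). Then q(1) = 0, and for every k ≥ 1 one has p(k) > 0, q(k) ≥ 0, r(k) > 0 and p(k) + q(k) + r(k) = 1. -/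
/-- probability of a down-step `k → k-1` of the birth and death process. -/
noncomputable def qseq (k : ℕ) : ℝ := (wseq k) ^ 2 * dseq (k - 1) / (12 * dseq k)

/-- probability of staying at `k` for the birth and death process. -/
noncomputable def rseq (k : ℕ) : ℝ := (wseq k) ^ 2 / 12

/-- probability of an up-step `k → k+1` of the birth and death process. -/
noncomputable def pseq (k : ℕ) : ℝ := (wseq k) ^ 2 * dseq (k + 1) / (12 * dseq k)

theorem wseq_pos {k : ℕ} (hk : 1 ≤ k) : 0 < wseq k := by
  have : (0 : ℝ) < k := by exact_mod_cast hk
  unfold wseq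
  positivity

theorem dseq_nonneg (k : ℕ) : 0 ≤ dseq k := by
  unfold dseq
  positivity

theorem dseq_pos {k : ℕ} (hk : 1 ≤ k) : 0 < dseq k := by
  have : (0 : ℝ) < k := by exact_mod_cast hk
  unfold dseq
  positivity

/-- The recursion obtained by linearising the equation satisfied by `wseq`. -/
theorem wseq_sq_mul_dseq_add (n : ℕ) :
    wseq (n + 1) ^ 2 * (dseq (n + 2) + dseq n + dseq (n + 1)) = 12 * dseq (n + 1) := by
  unfold wseq dseq
  push_cast
  have h1 : (n : ℝ) + 1 ≠ 0 := by positivity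
  have h2 : (n : ℝ) + 2 ≠ 0 := by positivity
  have h3 : (n : ℝ) + 3 ≠ 0 := by positivity
  have h4 : (n : ℝ) + 4 ≠ 0 := by positivity
  rw [show (n : ℝ) + 1 + 1 = n + 2 by ring, show (n : ℝ) + 1 + 2 = n + 3 by ring,
    show (n : ℝ) + 2 + 1 = n + 3 by ring, show (n : ℝ) + 2 + 2 = n + 4 by ring]
  field_simp
  ring

theorem stmt3 :
    qseq 1 = 0 ∧
    ∀ k : ℕ, 1 ≤ k →
      0 < pseq k ∧ 0 ≤ qseq k ∧ 0 < rseq k ∧ pseq k + qseq k + rseq k = 1 := by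
  refine ⟨by simp [qseq, dseq], fun k hk => ?_⟩
  have hw := wseq_pos hk
  have hd := dseq_pos hk
  have hd' := dseq_nonneg (k - 1)
  have hd'' : 0 < dseq (k + 1) := dseq_pos (Nat.le_add_left 1 k)
  refine ⟨by unfold pseq; positivity, by unfold qseq; positivity,
    by unfold rseq; positivity, ?_⟩
  obtain ⟨n, rfl⟩ := Nat.exists_eq_add_of_le' hk
  have key := wseq_sq_mul_dseq_add n
  simp only [pseq, qseq, rseq, Nat.add_sub_cancel]
  field_simp
  linarith
end

section
/- Let w : ℕ → ℝ be defined by w(0) = 0 and w(k) = 2k(k+3)/((k+1)(k+2)) for k ≥ 1, let d : ℕ → ℝ be defined by d(0) = 0 and d(k) = (3/280)·(k(k+3)/((k+1)(k+2)))·(5k⁴ + 30k³ + 59k² + 42k + 4) for k ≥ 1, and for k ≥ 1 set q(k) = w(k)²·d(k-1)/(12·d(k)), r(k) = w(k)²/12 and p(k) = w(k)²·d(k+1)/(12·d(k)). Then there exists a constant C > 0 such that for all k ≥ 1: |q(k) - 1/3 + 4/(3k)| ≤ C/k², |r(k) - 1/3 + 4/(3k²)| ≤ C/k³, and |p(k)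 - 1/3 - 4/(3k)| ≤ C/k². -/
/-- The quartic factor of `dseq`. -/
noncomputable def dquartic (x : ℝ) : ℝ := 5 * x ^ 4 + 30 * x ^ 3 + 59 * x ^ 2 + 42 * x + 4

lemma dquartic_pos {x : ℝ} (hx : 0 ≤ x) : 0 < dquartic x := by
  unfold dquartic; positivity

lemma qseq_eq {k : ℕ} (hk : 1 ≤ k) :
    qseq k = (k - 1) * (k + 3) * dquartic (k - 1) / (3 * (k + 1) ^ 2 * dquartic k) := by
  obtain ⟨n, rfl⟩ := Nat.exists_eq_add_of_le' hk
  have h := dquartic_pos (x := (n : ℝ) + 1) (by positivity)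
  simp only [qseq, wseq, dseq, Nat.add_sub_cancel, Nat.cast_add, Nat.cast_one, add_sub_cancel_right]
  rw [← dquartic, ← dquartic]
  field_simp
  ring

lemma pseq_eq {k : ℕ} (hk : 1 ≤ k) :
    pseq k = k * (k + 4) * dquartic (k + 1) / (3 * (k + 2) ^ 2 * dquartic k) := by
  have hk' : (0 : ℝ) < k := by exact_mod_cast hk
  have h := dquartic_pos hk'.le
  simp only [pseq, wseq, dseq, Nat.cast_add, Nat.cast_one]
  rw [← dquartic, ← dquartic]
  field_simp
  ring

lemma abs_div_le_div {a b c d : ℝ} (hb : 0 < b) (hd : 0 < d) (h₁ : 0 ≤ c * b + a * d)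
    (h₂ : 0 ≤ c * b - a * d) : |a / b| ≤ c / d := by
  rw [abs_div, abs_of_pos hb, div_le_div_iff₀ hb hd]
  calc |a| * d = |a * d| := by rw [abs_mul, abs_of_pos hd]
    _ ≤ c * b := abs_le.2 ⟨by linarith, by linarith⟩

theorem stmt4 :
    ∃ C : ℝ, 0 < C ∧ ∀ k : ℕ, 1 ≤ k →
      |qseq k - 1 / 3 + 4 / (3 * (k : ℝ))| ≤ C / (k : ℝ) ^ 2 ∧
      |rseq k - 1 / 3 + 4 / (3 * (k : ℝ) ^ 2)| ≤ C / (k : ℝ) ^ 3 ∧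
      |pseq k - 1 / 3 - 4 / (3 * (k : ℝ))| ≤ C / (k : ℝ) ^ 2 := by
  refine ⟨1000, by norm_num, fun k hk ↦ ?_⟩
  rw [qseq_eq hk, pseq_eq hk, rseq, wseq]
  obtain ⟨n, rfl⟩ := Nat.exists_eq_add_of_le' hk
  push_cast
  have hy : (0 : ℝ) ≤ n := n.cast_nonneg
  generalize (n : ℝ) = y at hy
  have h := dquartic_pos (x := y + 1) (by positivity)
  refine ⟨?_, ?_, ?_⟩
  · have e : (y + 1 - 1) * (y + 1 + 3) * dquartic (y + 1 - 1) /
        (3 * (y + 1 + 1) ^ 2 * dquartic (y + 1)) - 1 / 3 + 4 / (3 * (y + 1)) =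
        (y * (y + 4) * dquartic y * (y + 1) + (3 - y) * (y + 2) ^ 2 * dquartic (y + 1)) /
          (3 * (y + 1) * (y + 2) ^ 2 * dquartic (y + 1)) := by
      rw [add_sub_cancel_right, show y + 1 + 1 = y + 2 by ring]
      field_simp
      ring
    rw [e]
    apply abs_div_le_div (by positivity) (by positivity) <;>
    · unfold dquartic
      ring_nf
      positivity
  · have e : (2 * (y + 1) * (y + 1 + 3) / ((y + 1 + 1) * (y + 1 + 2))) ^ 2 / 12 - 1 / 3 +
        4 / (3 * (y + 1) ^ 2) =
        ((y + 1) ^ 4 * (y + 4) ^ 2 + (4 - (y + 1) ^ 2) * ((y + 2) * (y + 3)) ^ 2) /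
          (3 * (y + 1) ^ 2 * ((y + 2) * (y + 3)) ^ 2) := by
      rw [show y + 1 + 1 = y + 2 by ring, show y + 1 + 2 = y + 3 by ring]
      field_simp
      ring
    rw [e]
    apply abs_div_le_div (by positivity) (by positivity) <;>
    · ring_nf
      positivity
  · have e : (y + 1) * (y + 1 + 4) * dquartic (y + 1 + 1) /
        (3 * (y + 1 + 2) ^ 2 * dquartic (y + 1)) - 1 / 3 - 4 / (3 * (y + 1)) =
        ((y + 1) ^ 2 * (y + 5) * dquartic (y + 2) - (y + 5) * (y + 3) ^ 2 * dquartic (y + 1)) /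
          (3 * (y + 1) * (y + 3) ^ 2 * dquartic (y + 1)) := by
      rw [show y + 1 + 1 = y + 2 by ring, show y + 1 + 2 = y + 3 by ring]
      field_simp
      ring
    rw [e]
    apply abs_div_le_div (by positivity) (by positivity) <;>
    · unfold dquartic
      ring_nf
      positivity
end

section
/- Let a > 1 and c > 0 be real numbers and let p, q : ℕ → ℝ be sequences with p(k) > 0 and q(k) > 0 for all k ≥ 2, satisfying k²·|q(k)/p(k) - 1 + a/k| ≤ c for all k ≥ 2. For i ≥ 2 and ℓ ≥ 0 set m(i,ℓ) = ∏_{t=0}^{ℓ-1} q(i+t)/p(i+t) (so m(i,0) = 1). Then for every ε > 0 there exists K such that for all k ≥ K and all ℓ ≥ 0, |m(k,ℓ)·((k+ℓ)/k)^a - 1| ≤ ε. -/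
/-- Near `1`, the logarithm is its linear part up to a quadratic error. -/
theorem abs_log_sub_sub_one_le {y : ℝ} (hy : 1 / 2 ≤ y) :
    |Real.log y - (y - 1)| ≤ 2 * (y - 1) ^ 2 := by
  have hy0 : 0 < y := by linarith
  have hupper := Real.log_le_sub_one_of_pos hy0
  have hlower := Real.one_sub_inv_le_log_of_pos hy0
  have hinv : y⁻¹ ≤ 2 := by
    rw [inv_le_comm₀ hy0 two_pos]
    linarith
  have hid : 1 - y⁻¹ = (y - 1) - (y - 1) ^ 2 * y⁻¹ := by
    field_simp
    ring
  have hmul := mul_le_mul_of_nonneg_left hinv (sq_nonneg (y - 1))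
  rw [abs_le]
  constructor
  · linarith
  · nlinarith [sq_nonneg (y - 1)]

/-- If `r = 1 - a / x + O(1 / x ^ 2)`, then `log r + a * log ((x + 1) / x)` is `O(1 / x ^ 2)`. -/
theorem abs_log_add_mul_log_le {a c x r : ℝ} (ha : 0 < a) (hc : 0 < c) (hx : 1 ≤ x)
    (hx' : 2 * (a + c) ≤ x) (hr : x ^ 2 * |r - 1 + a / x| ≤ c) :
    0 < r ∧ |Real.log r + a * Real.log ((x + 1) / x)| ≤
      (a + c + 2 * (a + c) ^ 2) / x ^ 2 := by
  have hx0 : 0 < x := by linarith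
  have herr : |r - 1 + a / x| ≤ c / x ^ 2 := by
    rw [le_div_iff₀ (by positivity)]
    linarith
  have hsq : c / x ^ 2 ≤ c / x := by
    gcongr
    nlinarith
  have hdev : |r - 1| ≤ (a + c) / x := by
    have h := abs_sub (r - 1 + a / x) (a / x)
    rw [add_sub_cancel_right, abs_of_pos (div_pos ha hx0)] at h
    rw [add_div]
    linarith
  have hhalf : (a + c) / x ≤ 1 / 2 := by
    rw [div_le_iff₀ hx0]
    linarith
  have hr2 : 1 / 2 ≤ r := by linarith [(abs_le.mp hdev).1]
  have hlog := abs_log_sub_sub_one_le hr2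
  have hdev2 : (r - 1) ^ 2 ≤ (a + c) ^ 2 / x ^ 2 := by
    rw [← div_pow, ← sq_abs (r - 1)]
    gcongr
  have hpos : 0 < (x + 1) / x := by positivity
  have hu : Real.log ((x + 1) / x) ≤ 1 / x := by
    have h := Real.log_le_sub_one_of_pos hpos
    have h' : (x + 1) / x - 1 = 1 / x := by
      field_simp
      ring
    linarith
  have hl : 1 / x - 1 / x ^ 2 ≤ Real.log ((x + 1) / x) := by
    have h := Real.one_sub_inv_le_log_of_pos hpos
    refine le_trans ?_ h
    rw [inv_div, ← sub_nonneg]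
    have h' : 1 - x / (x + 1) - (1 / x - 1 / x ^ 2) = 1 / (x ^ 2 * (x + 1)) := by
      field_simp
      ring
    rw [h']
    positivity
  have hau := mul_le_mul_of_nonneg_left hu ha.le
  have hal := mul_le_mul_of_nonneg_left hl ha.le
  have e1 : a * (1 / x) = a / x := by ring
  have e2 : a * (1 / x - 1 / x ^ 2) = a / x - a / x ^ 2 := by ring
  have e3 : (a + c + 2 * (a + c) ^ 2) / x ^ 2 =
      a / x ^ 2 + c / x ^ 2 + 2 * ((a + c) ^ 2 / x ^ 2) := by ring
  have hapos : 0 < a / x ^ 2 := by positivity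
  rw [e1] at hau
  rw [e2] at hal
  rw [abs_le] at herr hlog
  refine ⟨by linarith, ?_⟩
  rw [e3, abs_le]
  constructor <;> linarith [herr.1, herr.2, hlog.1, hlog.2]

theorem div_sq_le_telescope {C x : ℝ} (hC : 0 ≤ C) (hx : 1 ≤ x) :
    C / x ^ 2 ≤ 2 * C * (1 / x - 1 / (x + 1)) := by
  have hx0 : 0 < x := by linarith
  have h : 2 * C * (1 / x - 1 / (x + 1)) - C / x ^ 2 = C * (x - 1) / (x ^ 2 * (x + 1)) := by
    field_simp
    ring
  rw [← sub_nonneg, h]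
  have : 0 ≤ x - 1 := by linarith
  positivity

theorem stmt7 (a c : ℝ) (ha : 1 < a) (hc : 0 < c) (p q : ℕ → ℝ)
    (hp : ∀ k : ℕ, 2 ≤ k → 0 < p k) (hq : ∀ k : ℕ, 2 ≤ k → 0 < q k)
    (hratio : ∀ k : ℕ, 2 ≤ k → (k : ℝ) ^ 2 * |q k / p k - 1 + a / (k : ℝ)| ≤ c) :
    ∀ ε : ℝ, 0 < ε → ∃ K : ℕ, ∀ k : ℕ, K ≤ k → ∀ ℓ : ℕ,
      |(∏ t ∈ Finset.range ℓ, q (k + t) / p (k + t)) *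
          (((k : ℝ) + (ℓ : ℝ)) / (k : ℝ)) ^ a - 1| ≤ ε := by
  intro ε hε
  have ha0 : 0 < a := by linarith
  set C := a + c + 2 * (a + c) ^ 2 with hCdef
  have hC : 0 < C := by positivity
  obtain ⟨K, hK⟩ := exists_nat_ge (2 + 2 * (a + c) + 2 * C + 4 * C / ε)
  refine ⟨K, fun k hk ℓ => ?_⟩
  have hkK : (K : ℝ) ≤ k := by exact_mod_cast hk
  have hq0 : 0 < 4 * C / ε := by positivity
  have hk2 : (2 : ℝ) ≤ k := by linarith
  have hk2' : 2 ≤ k := by exact_mod_cast hk2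
  have hk0 : (0 : ℝ) < k := by linarith
  have key : ∀ ℓ : ℕ, ∃ s : ℝ, |s| ≤ 2 * C * (1 / (k : ℝ) - 1 / ((k : ℝ) + ℓ)) ∧
      (∏ t ∈ Finset.range ℓ, q (k + t) / p (k + t)) *
        (((k : ℝ) + (ℓ : ℝ)) / (k : ℝ)) ^ a = Real.exp s := by
    intro ℓ
    induction ℓ with
    | zero => exact ⟨0, by simp, by simp [hk0.ne']⟩
    | succ n ih =>
      obtain ⟨s, hs, hprod⟩ := ih
      set x : ℝ := (k : ℝ) + n with hxdef
      have hn : (0 : ℝ) ≤ n := n.cast_nonneg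
      have hx1 : 1 ≤ x := by linarith
      have hx0 : 0 < x := by linarith
      have hr := hratio (k + n) (by omega)
      rw [Nat.cast_add, ← hxdef] at hr
      obtain ⟨hrpos, hbound⟩ := abs_log_add_mul_log_le ha0 hc hx1 (by linarith) hr
      refine ⟨s + (Real.log (q (k + n) / p (k + n)) + a * Real.log ((x + 1) / x)), ?_, ?_⟩
      · have ht := div_sq_le_telescope hC.le hx1
        have htri := abs_add_le s
          (Real.log (q (k + n) / p (k + n)) + a * Real.log ((x + 1) / x))
        have hcast : (k : ℝ) + ((n + 1 : ℕ) : ℝ) = x + 1 := by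
          rw [hxdef]
          push_cast
          ring
        rw [hcast]
        linarith
      · have hcast : ((k : ℝ) + ((n + 1 : ℕ) : ℝ)) / k = x / k * ((x + 1) / x) := by
          rw [div_mul_div_comm, mul_comm x (x + 1), mul_div_mul_right _ _ hx0.ne', hxdef]
          push_cast
          ring
        rw [hcast, Real.mul_rpow (by positivity) (by positivity), Finset.prod_range_succ,
          Real.exp_add, ← hprod, Real.exp_add, Real.exp_log hrpos, mul_comm a,
          ← Real.rpow_def_of_pos (by positivity)]
        ring
  obtain ⟨s, hs, hprod⟩ := key ℓ
  have hs' : |s| ≤ 2 * C / k := by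
    have h : 0 ≤ 2 * C * (1 / ((k : ℝ) + ℓ)) := by positivity
    have h' : 2 * C / (k : ℝ) = 2 * C * (1 / k) := by ring
    linarith
  have hs1 : |s| ≤ 1 := by
    refine hs'.trans ?_
    rw [div_le_one hk0]
    linarith
  have hsε : 2 * (2 * C / k) ≤ ε := by
    have h : 4 * C / ε ≤ k := by linarith
    rw [div_le_iff₀ hε] at h
    rw [← mul_div_assoc, div_le_iff₀ hk0]
    linarith
  rw [hprod]
  linarith [Real.abs_exp_sub_one_le hs1]
end

section
/- Let a > 1 and c > 0 be real numbers and let p, q : ℕ → ℝ be sequences with p(k) > 0 and q(k) > 0 for all k ≥ 2, satisfying k²·|q(k)/p(k) - 1 + a/k| ≤ c for all k ≥ 2. For i ≥ 2 and ℓ ≥ 0 set m(i,ℓ) = ∏_{t=0}^{ℓ-1} q(i+t)/p(i+t) (so m(i,0) = 1). Then for each k ≥ 2 the series ∑_{ℓ=0}^∞ m(k,ℓ) converges, and (1/k)·∑_{ℓ=0}^∞ m(k,ℓ) → 1/(a-1) as k → ∞. -/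
open Filter

/-- Discrete telescoping for the products of consecutive values of `r`. -/
theorem sum_prod_mul_sub_telescope (r f : ℕ → ℝ) (k n : ℕ) :
    ∑ l ∈ Finset.range n, (∏ t ∈ Finset.range l, r (k + t)) *
        (f (k + l) - r (k + l) * f (k + l + 1)) =
      f k - (∏ t ∈ Finset.range n, r (k + t)) * f (k + n) := by
  induction n with
  | zero => simp
  | succ n ih =>
    rw [Finset.sum_range_succ, ih, Finset.prod_range_succ, ← add_assoc]
    ring

/-- A nonnegative supersolution of `f k - r k * f (k + 1) = 1` dominates the series of products. -/
theorem summable_prod_and_tsum_le_of_supersolution {r f : ℕ → ℝ} {k : ℕ}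
    (hr : ∀ j, k ≤ j → 0 < r j) (hf : ∀ j, k ≤ j → 0 ≤ f j)
    (hsuper : ∀ j, k ≤ j → 1 ≤ f j - r j * f (j + 1)) :
    Summable (fun l : ℕ => ∏ t ∈ Finset.range l, r (k + t)) ∧
      ∑' l : ℕ, ∏ t ∈ Finset.range l, r (k + t) ≤ f k := by
  have hpos : ∀ l : ℕ, 0 ≤ ∏ t ∈ Finset.range l, r (k + t) := fun l =>
    Finset.prod_nonneg fun t _ => (hr _ (Nat.le_add_right k t)).le
  have hbound : ∀ n : ℕ,
      ∑ l ∈ Finset.range n, ∏ t ∈ Finset.range l, r (k + t) ≤ f k := by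
    intro n
    calc ∑ l ∈ Finset.range n, ∏ t ∈ Finset.range l, r (k + t)
        ≤ ∑ l ∈ Finset.range n, (∏ t ∈ Finset.range l, r (k + t)) *
            (f (k + l) - r (k + l) * f (k + l + 1)) :=
          Finset.sum_le_sum fun l _ =>
            le_mul_of_one_le_right (hpos l) (hsuper _ (Nat.le_add_right k l))
      _ = f k - (∏ t ∈ Finset.range n, r (k + t)) * f (k + n) :=
          sum_prod_mul_sub_telescope r f k n
      _ ≤ f k := sub_le_self _ (mul_nonneg (hpos n) (hf _ (Nat.le_add_right k n)))
  exact ⟨summable_of_sum_range_le hpos hbound, Real.tsum_le_of_sum_range_le hpos hbound⟩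

/-- A linear subsolution of `f k - r k * f (k + 1) = 1` is dominated by the series of products,
provided that series converges. -/
theorem mul_le_tsum_prod_of_subsolution {r : ℕ → ℝ} {β : ℝ} {k : ℕ} (hk : 0 < k)
    (hr : ∀ j, k ≤ j → 0 < r j)
    (hsub : ∀ j : ℕ, k ≤ j → β * (j - r j * (j + 1)) ≤ 1)
    (hsum : Summable (fun l : ℕ => ∏ t ∈ Finset.range l, r (k + t))) :
    β * k ≤ ∑' l : ℕ, ∏ t ∈ Finset.range l, r (k + t) := by
  have hpos : ∀ l : ℕ, 0 ≤ ∏ t ∈ Finset.range l, r (k + t) := fun l =>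
    Finset.prod_nonneg fun t _ => (hr _ (Nat.le_add_right k t)).le
  by_contra! hlt
  set S := ∑' l : ℕ, ∏ t ∈ Finset.range l, r (k + t)
  have hlower : ∀ n : ℕ,
      β * k - S ≤ (∏ t ∈ Finset.range n, r (k + t)) * (β * ((k + n : ℕ) : ℝ)) := by
    intro n
    have htel := sum_prod_mul_sub_telescope r (fun j => β * (j : ℝ)) k n
    have hle : ∑ l ∈ Finset.range n, (∏ t ∈ Finset.range l, r (k + t)) *
        (β * ((k + l : ℕ) : ℝ) - r (k + l) * (β * ((k + l + 1 : ℕ) : ℝ))) ≤ S := by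
      refine (Finset.sum_le_sum fun l _ => ?_).trans
        (hsum.sum_le_tsum (Finset.range n) fun l _ => hpos l)
      refine mul_le_of_le_one_right (hpos l) ?_
      have := hsub (k + l) (Nat.le_add_right k l)
      push_cast at this ⊢
      linarith
    linarith
  have hharm : Summable (fun n : ℕ => 1 / ((n + k : ℕ) : ℝ)) := by
    refine Summable.of_nonneg_of_le (fun n => by positivity) (fun n => ?_)
      (hsum.mul_left (β / (β * k - S)))
    have hδ : 0 < β * k - S := sub_pos.mpr hlt
    have hkn : (0 : ℝ) < ((n + k : ℕ) : ℝ) := by positivity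
    have := hlower n
    rw [add_comm k n] at this
    rw [div_le_iff₀ hkn, div_mul_eq_mul_div, div_mul_eq_mul_div, le_div_iff₀ hδ]
    linarith
  exact Real.not_summable_one_div_natCast
    ((summable_nat_add_iff (f := fun n : ℕ => 1 / (n : ℝ)) k).mp hharm)

/-- Convergence of the series of products does not depend on the starting index. -/
theorem summable_prod_of_summable_prod_add {r : ℕ → ℝ} {k : ℕ} (N : ℕ)
    (hsum : Summable (fun l : ℕ => ∏ t ∈ Finset.range l, r (k + N + t))) :
    Summable (fun l : ℕ => ∏ t ∈ Finset.range l, r (k + t)) := by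
  rw [← summable_nat_add_iff N]
  refine (hsum.mul_left (∏ t ∈ Finset.range N, r (k + t))).congr fun l => ?_
  rw [add_comm l N, Finset.prod_range_add]
  simp only [add_assoc]

theorem tendsto_sub_mul_succ {a c : ℝ} (ha : 0 ≤ a) {r : ℕ → ℝ}
    (hr : ∀ k : ℕ, 2 ≤ k → (k : ℝ) ^ 2 * |r k - 1 + a / (k : ℝ)| ≤ c) :
    Tendsto (fun k : ℕ => (k : ℝ) - r k * (k + 1)) atTop (nhds (a - 1)) := by
  rw [tendsto_iff_norm_sub_tendsto_zero]
  refine squeeze_zero' (.of_forall fun k => norm_nonneg _) ?_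
    (tendsto_const_div_atTop_nhds_zero_nat (a + 2 * c))
  filter_upwards [eventually_ge_atTop 2] with k hk
  have hk1 : (1 : ℝ) ≤ k := by exact_mod_cast (by omega : 1 ≤ k)
  have hk0 : (0 : ℝ) < k := by linarith
  have hdecomp : (k : ℝ) - r k * (k + 1) - (a - 1) =
      a / k - (k + 1) * (r k - 1 + a / k) := by
    field_simp
    ring
  have hmul : ((k : ℝ) + 1) * |r k - 1 + a / k| ≤ 2 * c / k := by
    rw [le_div_iff₀ hk0]
    nlinarith [hr k hk, mul_nonneg (mul_nonneg hk0.le (sub_nonneg.mpr hk1))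
      (abs_nonneg (r k - 1 + a / k))]
  rw [Real.norm_eq_abs, hdecomp]
  calc |a / k - (k + 1) * (r k - 1 + a / k)|
      ≤ |a / k| + |(k + 1) * (r k - 1 + a / k)| := abs_sub _ _
    _ = a / k + (k + 1) * |r k - 1 + a / k| := by
        rw [abs_mul, abs_of_nonneg (div_nonneg ha hk0.le),
          abs_of_pos (by linarith : (0 : ℝ) < k + 1)]
    _ ≤ (a + 2 * c) / k := by rw [add_div]; linarith

theorem stmt8 (a c : ℝ) (ha : 1 < a) (hc : 0 < c) (p q : ℕ → ℝ)
    (hp : ∀ k : ℕ, 2 ≤ k → 0 < p k) (hq : ∀ k : ℕ, 2 ≤ k → 0 < q k)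
    (hratio : ∀ k : ℕ, 2 ≤ k → (k : ℝ) ^ 2 * |q k / p k - 1 + a / (k : ℝ)| ≤ c) :
    (∀ k : ℕ, 2 ≤ k →
      Summable (fun ℓ : ℕ => ∏ t ∈ Finset.range ℓ, q (k + t) / p (k + t))) ∧
    Tendsto
      (fun k : ℕ => (1 / (k : ℝ)) *
        ∑' ℓ : ℕ, ∏ t ∈ Finset.range ℓ, q (k + t) / p (k + t))
      atTop (nhds (1 / (a - 1))) := by
  set r : ℕ → ℝ := fun k => q k / p k
  have hr : ∀ k, 2 ≤ k → 0 < r k := fun k hk => div_pos (hq k hk) (hp k hk)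
  have ha1 : 0 < a - 1 := sub_pos.mpr ha
  have hlim := tendsto_sub_mul_succ (by linarith : 0 ≤ a) (r := r) hratio
  have hupper : ∀ β : ℝ, 1 / (a - 1) < β → ∃ K : ℕ, ∀ k : ℕ, K ≤ k →
      Summable (fun l : ℕ => ∏ t ∈ Finset.range l, r (k + t)) ∧
        ∑' l : ℕ, ∏ t ∈ Finset.range l, r (k + t) ≤ β * k := by
    intro β hβ
    have hβ0 : 0 < β := (one_div_pos.mpr ha1).trans hβ
    have hev := (hlim.const_mul β).eventually_const_lt ((div_lt_iff₀ ha1).mp hβ)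
    obtain ⟨K, hK⟩ := eventually_atTop.mp (hev.and (eventually_ge_atTop 2))
    refine ⟨K, fun k hk => summable_prod_and_tsum_le_of_supersolution (f := fun j => β * (j : ℝ))
      (fun j hj => hr j (hK j (hk.trans hj)).2) (fun j _ => by positivity) fun j hj => ?_⟩
    have := (hK j (hk.trans hj)).1
    push_cast
    linarith
  have hsummable : ∀ k : ℕ, Summable (fun l : ℕ => ∏ t ∈ Finset.range l, r (k + t)) := by
    intro k
    obtain ⟨K, hK⟩ := hupper (1 / (a - 1) + 1) (by linarith)
    exact summable_prod_of_summable_prod_add K (hK (k + K) (Nat.le_add_left K k)).1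
  refine ⟨fun k _ => hsummable k, tendsto_order.mpr ⟨fun b hb => ?_, fun b hb => ?_⟩⟩
  · obtain ⟨β, hbβ, hβ⟩ := exists_between hb
    have hev := (hlim.const_mul β).eventually_lt_const ((lt_div_iff₀ ha1).mp hβ)
    obtain ⟨K, hK⟩ := eventually_atTop.mp (hev.and (eventually_ge_atTop 2))
    filter_upwards [eventually_ge_atTop K] with k hk
    have hk0 : 0 < k := by have := (hK k hk).2; omega
    have hle := mul_le_tsum_prod_of_subsolution hk0
      (fun j hj => hr j (hK j (hk.trans hj)).2) (fun j hj => (hK j (hk.trans hj)).1.le)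
      (hsummable k)
    rw [one_div_mul_eq_div]
    exact hbβ.trans_le ((le_div_iff₀ (Nat.cast_pos.mpr hk0)).mpr hle)
  · obtain ⟨β, hβ, hβb⟩ := exists_between hb
    obtain ⟨K, hK⟩ := hupper β hβ
    filter_upwards [eventually_ge_atTop K, eventually_gt_atTop 0] with k hk hk0
    rw [one_div_mul_eq_div]
    exact ((div_le_iff₀ (Nat.cast_pos.mpr hk0)).mpr (hK k hk).2).trans_lt hβb
end

section
/- Let a > 1, b < 1 and c > 0 be real numbers and let p, q, r : ℕ → ℝ be sequences with: q(1) = 0; p(k) > 0 for all k ≥ 1 and q(k) > 0 for all k ≥ 2; p(k), q(k), r(k) ≥ 0 and p(k) + q(k) + r(k) = 1 for all k ≥ 1; k²·|q(k)/p(k) - 1 + a/k| ≤ c for all k ≥ 2; and r(k) → b as k → ∞. For i ≥ 2 and ℓ ≥ 0 set m(i,ℓ) = ∏_{t=0}^{ℓ-1} q(i+t)/p(i+t) (so m(i,0) = 1). Then, for each k ≥ 1, S(k) := (∑_{ℓ=0}^∞ m(k+1,ℓ))/p(k) is finite, and S(k)/k → 2/((1-b)(a-1)) as k → ∞. -/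
open Filter

/-- The tail products `∏_{t < n} x (k + t)` of a sequence `x`. -/
def tailProd (x : ℕ → ℝ) (k n : ℕ) : ℝ := ∏ t ∈ Finset.range n, x (k + t)

theorem tailProd_nonneg {x : ℕ → ℝ} {k : ℕ} (hx : ∀ j, k ≤ j → 0 ≤ x j) (n : ℕ) :
    0 ≤ tailProd x k n :=
  Finset.prod_nonneg fun t _ => hx _ (Nat.le_add_right k t)

theorem tailProd_add (x : ℕ → ℝ) (k N n : ℕ) :
    tailProd x k (n + N) = tailProd x k N * tailProd x (k + N) n := by
  simp only [tailProd]
  rw [add_comm n N, Finset.prod_range_add]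
  simp only [add_assoc]

theorem sum_tailProd_mul (x : ℕ → ℝ) (k N : ℕ) :
    ∑ n ∈ Finset.range N, tailProd x (k + 1) n *
        (((k + 1 + n : ℕ) : ℝ) - 1 - ((k + 1 + n : ℕ) : ℝ) * x (k + 1 + n)) =
      k - (k + N) * tailProd x (k + 1) N := by
  induction N with
  | zero => simp [tailProd]
  | succ N ih =>
    have h : tailProd x (k + 1) (N + 1) = tailProd x (k + 1) N * x (k + 1 + N) :=
      Finset.prod_range_succ _ _
    rw [Finset.sum_range_succ, ih, h]
    push_cast
    ring

/-- A quantitative form of Raabe's test. -/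
theorem summable_tailProd_and_bounds {x : ℕ → ℝ} {k : ℕ} {lo hi : ℝ} (hlo : 0 < lo)
    (hx : ∀ j, k + 1 ≤ j → 0 ≤ x j)
    (hl : ∀ j : ℕ, k + 1 ≤ j → lo ≤ (j : ℝ) - 1 - j * x j)
    (hh : ∀ j : ℕ, k + 1 ≤ j → (j : ℝ) - 1 - j * x j ≤ hi) :
    Summable (tailProd x (k + 1)) ∧ lo * ∑' n, tailProd x (k + 1) n ≤ k ∧
      k ≤ hi * ∑' n, tailProd x (k + 1) n := by
  have m0 := tailProd_nonneg hx
  have hhi : 0 < hi := hlo.trans_le ((hl _ le_rfl).trans (hh _ le_rfl))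
  have hup (N : ℕ) : ∑ n ∈ Finset.range N, tailProd x (k + 1) n ≤ k / lo := by
    rw [le_div_iff₀ hlo, Finset.sum_mul]
    calc _ ≤ _ := Finset.sum_le_sum fun n _ =>
          mul_le_mul_of_nonneg_left (hl (k + 1 + n) (Nat.le_add_right _ _)) (m0 n)
      _ = _ := sum_tailProd_mul x k N
      _ ≤ k := sub_le_self _ (mul_nonneg (by positivity) (m0 N))
  have hs : Summable (tailProd x (k + 1)) := summable_of_sum_range_le m0 hup
  refine ⟨hs, ?_, ?_⟩
  · rw [mul_comm, ← le_div_iff₀ hlo]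
    exact Real.tsum_le_of_sum_range_le m0 hup
  · by_contra! hlt
    set d : ℝ := k - hi * ∑' n, tailProd x (k + 1) n with hd
    have hd0 : 0 < d := sub_pos.2 hlt
    have hw (N : ℕ) : d ≤ (k + N) * tailProd x (k + 1) N := by
      have h1 : (k : ℝ) - (k + N) * tailProd x (k + 1) N ≤
          (∑ n ∈ Finset.range N, tailProd x (k + 1) n) * hi := by
        rw [← sum_tailProd_mul, Finset.sum_mul]
        exact Finset.sum_le_sum fun n _ =>
          mul_le_mul_of_nonneg_left (hh (k + 1 + n) (Nat.le_add_right _ _)) (m0 n)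
      have h2 := mul_le_mul_of_nonneg_right
        (hs.sum_le_tsum (Finset.range N) fun n _ => m0 n) hhi.le
      linarith
    have hharm : Summable fun n : ℕ => 1 / ((n + k : ℕ) : ℝ) := by
      refine Summable.of_nonneg_of_le (fun n => by positivity) (fun n => ?_) (hs.mul_left d⁻¹)
      rcases Nat.eq_zero_or_pos (n + k) with h | h
      · rw [h]
        simpa using mul_nonneg (inv_nonneg.2 hd0.le) (m0 n)
      · have hpos : (0 : ℝ) < ((n + k : ℕ) : ℝ) := by exact_mod_cast h
        have := hw n
        rw [div_le_iff₀ hpos, mul_assoc, inv_mul_eq_div, one_le_div hd0]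
        push_cast
        linarith
    exact Real.not_summable_one_div_natCast
      ((summable_nat_add_iff (f := fun n : ℕ => 1 / (n : ℝ)) k).1 hharm)

theorem summable_tailProd {x : ℕ → ℝ} {a : ℝ} (ha : 1 < a)
    (hx : ∀ᶠ j in atTop, 0 ≤ x j)
    (hlim : Tendsto (fun j : ℕ => (j : ℝ) - j * x j) atTop (nhds a)) (k : ℕ) :
    Summable (tailProd x k) := by
  have hlo : ∀ᶠ j : ℕ in atTop, (1 + a) / 2 < (j : ℝ) - j * x j :=
    hlim.eventually_const_lt (by linarith)
  have hhi : ∀ᶠ j : ℕ in atTop, (j : ℝ) - j * x j < a + 1 :=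
    hlim.eventually_lt_const (by linarith)
  obtain ⟨K, hK⟩ := eventually_atTop.1 (hx.and (hlo.and hhi))
  have hs : Summable (tailProd x (k + (K + 1))) := by
    rw [← add_assoc]
    refine (summable_tailProd_and_bounds (lo := (a - 1) / 2) (hi := a) (by linarith)
      (fun j hj => (hK j (by omega)).1) (fun j hj => ?_) (fun j hj => ?_)).1
    · have := (hK j (by omega)).2.1
      linarith
    · have := (hK j (by omega)).2.2
      linarith
  rw [← summable_nat_add_iff (K + 1)]
  simp only [tailProd_add]
  exact hs.mul_left _

theorem tendsto_tsum_tailProd_div {x : ℕ → ℝ} {a : ℝ} (ha : 1 < a)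
    (hx : ∀ᶠ j in atTop, 0 ≤ x j)
    (hlim : Tendsto (fun j : ℕ => (j : ℝ) - j * x j) atTop (nhds a)) :
    Tendsto (fun k : ℕ => (∑' n, tailProd x (k + 1) n) / (k : ℝ)) atTop
      (nhds (1 / (a - 1))) := by
  suffices h : Tendsto (fun k : ℕ => (k : ℝ) / ∑' n, tailProd x (k + 1) n) atTop
      (nhds (a - 1)) by
    simpa using h.inv₀ (by linarith)
  rw [Metric.tendsto_nhds]
  intro ε hε
  set δ := min (ε / 2) ((a - 1) / 2) with hδ
  have hδ0 : 0 < δ := lt_min (by linarith) (by linarith)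
  have hδε : δ < ε := (min_le_left _ _).trans_lt (by linarith)
  have hδa : δ ≤ (a - 1) / 2 := min_le_right _ _
  have hlo : ∀ᶠ j : ℕ in atTop, a - δ < (j : ℝ) - j * x j :=
    hlim.eventually_const_lt (by linarith)
  have hhi : ∀ᶠ j : ℕ in atTop, (j : ℝ) - j * x j < a + δ :=
    hlim.eventually_lt_const (by linarith)
  obtain ⟨K, hK⟩ := eventually_atTop.1 (hx.and (hlo.and hhi))
  filter_upwards [eventually_ge_atTop K] with k hk
  obtain ⟨hs, h1, h2⟩ := summable_tailProd_and_bounds (x := x) (k := k) (lo := a - 1 - δ)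
    (hi := a - 1 + δ) (by linarith) (fun j hj => (hK j (by omega)).1)
    (fun j hj => by
      have := (hK j (by omega)).2.1
      linarith)
    (fun j hj => by
      have := (hK j (by omega)).2.2
      linarith)
  have hT : 0 < ∑' n, tailProd x (k + 1) n :=
    hs.tsum_pos (tailProd_nonneg fun j hj => (hK j (by omega)).1) 0 (by simp [tailProd])
  rw [Real.dist_eq, abs_lt]
  have h3 := (le_div_iff₀ hT).2 h1
  have h4 := (div_le_iff₀ hT).2 h2
  constructor <;> linarith

theorem tendsto_sub_mul_of_sq_mul_abs_le {x : ℕ → ℝ} {a c : ℝ}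
    (h : ∀ k : ℕ, 2 ≤ k → (k : ℝ) ^ 2 * |x k - 1 + a / (k : ℝ)| ≤ c) :
    Tendsto (fun j : ℕ => (j : ℝ) - j * x j) atTop (nhds a) := by
  rw [tendsto_iff_dist_tendsto_zero]
  refine squeeze_zero' (Eventually.of_forall fun _ => dist_nonneg) ?_
    (tendsto_const_div_atTop_nhds_zero_nat c)
  filter_upwards [eventually_ge_atTop 2] with j hj
  have hj0 : (0 : ℝ) < j := by exact_mod_cast (by omega : 0 < j)
  have e : (j : ℝ) - j * x j - a = -(j * (x j - 1 + a / j)) := by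
    field_simp
    ring
  rw [Real.dist_eq, e, abs_neg, abs_mul, abs_of_pos hj0, le_div_iff₀ hj0]
  linarith [h j hj]

theorem tendsto_one_of_tendsto_sub_mul {x : ℕ → ℝ} {a : ℝ}
    (h : Tendsto (fun j : ℕ => (j : ℝ) - j * x j) atTop (nhds a)) :
    Tendsto x atTop (nhds 1) := by
  have h1 : Tendsto (fun j : ℕ => 1 - ((j : ℝ) - j * x j) / j) atTop (nhds (1 - 0)) :=
    tendsto_const_nhds.sub (h.div_atTop tendsto_natCast_atTop_atTop)
  rw [sub_zero] at h1
  refine h1.congr' ?_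
  filter_upwards [eventually_gt_atTop 0] with j hj
  have hj0 : (0 : ℝ) < j := by exact_mod_cast hj
  field_simp
  ring

theorem stmt9 (a b c : ℝ) (ha : 1 < a) (hb : b < 1) (hc : 0 < c)
    (p q r : ℕ → ℝ)
    (hq1 : q 1 = 0)
    (hp : ∀ k : ℕ, 1 ≤ k → 0 < p k)
    (hq : ∀ k : ℕ, 2 ≤ k → 0 < q k)
    (hnn : ∀ k : ℕ, 1 ≤ k → 0 ≤ p k ∧ 0 ≤ q k ∧ 0 ≤ r k)
    (hsum : ∀ k : ℕ, 1 ≤ k → p k + q k + r k = 1)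
    (hratio : ∀ k : ℕ, 2 ≤ k → (k : ℝ) ^ 2 * |q k / p k - 1 + a / (k : ℝ)| ≤ c)
    (hr : Tendsto r atTop (nhds b)) :
    (∀ k : ℕ, 1 ≤ k →
      Summable (fun ℓ : ℕ => ∏ t ∈ Finset.range ℓ, q (k + 1 + t) / p (k + 1 + t))) ∧
    Tendsto
      (fun k : ℕ =>
        ((∑' ℓ : ℕ, ∏ t ∈ Finset.range ℓ, q (k + 1 + t) / p (k + 1 + t)) / p k) / (k : ℝ))
      atTop (nhds (2 / ((1 - b) * (a - 1)))) := by
  have hlim := tendsto_sub_mul_of_sq_mul_abs_le (x := fun k => q k / p k) hratio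
  have hx : ∀ᶠ j in atTop, 0 ≤ q j / p j := by
    filter_upwards [eventually_ge_atTop 1] with j hj
    exact div_nonneg (hnn j hj).2.1 (hnn j hj).1
  refine ⟨fun k _ => summable_tailProd ha hx hlim (k + 1), ?_⟩
  have hpinv : Tendsto (fun k => 1 / p k) atTop (nhds (2 / (1 - b))) := by
    have h1 : Tendsto (fun k => (1 + q k / p k) / (1 - r k)) atTop
        (nhds ((1 + 1) / (1 - b))) :=
      ((tendsto_one_of_tendsto_sub_mul hlim).const_add 1).div (hr.const_sub 1) (by linarith)
    rw [one_add_one_eq_two] at h1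
    refine h1.congr' ?_
    filter_upwards [eventually_ge_atTop 1] with k hk
    have hpk := hp k hk
    have h2 : 1 - r k = p k + q k := by linarith [hsum k hk]
    have h3 : 0 < p k + q k := by linarith [(hnn k hk).2.1]
    rw [h2]
    field_simp
  have h := hpinv.mul (tendsto_tsum_tailProd_div ha hx hlim)
  rw [div_mul_div_comm, mul_one] at h
  refine h.congr fun k => ?_
  simp only [tailProd]
  ring
end

section
/- Let w : ℕ → ℝ be defined by w(0) = 0 and w(k) = 2k(k+3)/((k+1)(k+2)) for k ≥ 1. A labeled walk from k to j (k, j ≥ 1) is a finite sequence θ = (θ_0, θ_1, …, θ_L) of positive integers, L ≥ 0, with θ_0 = k, θ_L = j and |θ_{t+1} - θ_t| ≤ 1 for 0 ≤ t < L; its weight is 12^{-L}·∏_{t=0}^{L-1} w(θ_t)·w(θ_{t+1}). Define G(k,j) ∈ [0,∞] as the sum of the weights of all labeled walks from k to j. Then there exist constants 0 < c ≤ C such that for all integers j > k ≥ 1: c·k⁴/j³ ≤ G(k,j) ≤ C·k⁴/j³; in particular G(k,j) is finite for j > k. -/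
open scoped ENNReal

/-- A labeled walk from `k` to `j` of length `L`, encoded as a function
`θ : ℕ → ℕ` with `θ 0 = k`, `θ t = j` for all `t ≥ L` (so in particular
`θ L = j`), consecutive values differing by at most 1 up to time `L`, and all
values positive. -/
def IsLWalk (k j L : ℕ) (θ : ℕ → ℕ) : Prop :=
  θ 0 = k ∧ (∀ t : ℕ, L ≤ t → θ t = j) ∧
    (∀ t : ℕ, t < L → θ (t + 1) ≤ θ t + 1 ∧ θ t ≤ θ (t + 1) + 1) ∧
    (∀ t : ℕ, 1 ≤ θ t)

/-- The type of labeled walks from `k` to `j`: a length together with the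
sequence of labels. -/
def LWalk (k j : ℕ) : Type :=
  { x : ℕ × (ℕ → ℕ) // IsLWalk k j x.1 x.2 }

/-- The weight `12^{-L} ∏_{t<L} w(θ_t) w(θ_{t+1})` of a walk, in `[0,∞]`. -/
noncomputable def walkWeight (L : ℕ) (θ : ℕ → ℕ) : ℝ≥0∞ :=
  (∏ t ∈ Finset.range L, ENNReal.ofReal (wseq (θ t) * wseq (θ (t + 1)))) /
    12 ^ L

/-- `Gfun k j ∈ [0,∞]` is the sum of the weights of all labeled walks from `k`
to `j`.  (For `j = 0` there are no such walks, so `Gfun k 0 = 0`.) -/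
noncomputable def Gfun (k j : ℕ) : ℝ≥0∞ :=
  ∑' x : LWalk k j, walkWeight x.1.1 x.1.2

open Classical in
/-- The total weight of the labeled walks of length `L` from `k` to `j`. -/
noncomputable def walkSum (j L k : ℕ) : ℝ≥0∞ :=
  ∑' θ : ℕ → ℕ, if IsLWalk k j L θ then walkWeight L θ else 0

/-- A sequence is its first term together with its tail. -/
def consEquiv : ℕ × (ℕ → ℕ) ≃ (ℕ → ℕ) where
  toFun p n := Nat.casesOn n p.1 p.2
  invFun θ := (θ 0, fun n => θ (n + 1))
  left_inv _ := rfl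
  right_inv θ := by
    funext n
    cases n <;> rfl

theorem consEquiv_zero (a : ℕ) (θ : ℕ → ℕ) : consEquiv (a, θ) 0 = a := rfl

theorem consEquiv_succ (a : ℕ) (θ : ℕ → ℕ) (n : ℕ) : consEquiv (a, θ) (n + 1) = θ n := rfl

theorem Gfun_eq_tsum_walkSum (k j : ℕ) : Gfun k j = ∑' L, walkSum j L k := by
  classical
  refine (tsum_subtype {x : ℕ × (ℕ → ℕ) | IsLWalk k j x.1 x.2}
    (fun x => walkWeight x.1 x.2)).trans ?_
  rw [ENNReal.tsum_prod']
  rfl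

theorem walkSum_label_zero (j L : ℕ) : walkSum j L 0 = 0 := by
  unfold walkSum
  rw [ENNReal.tsum_eq_zero]
  intro θ
  rw [if_neg]
  rintro ⟨h0, -, -, h⟩
  have := h 0
  omega

theorem walkSum_length_zero {j k : ℕ} (hk : 1 ≤ k) :
    walkSum j 0 k = if k = j then 1 else 0 := by
  unfold walkSum
  split_ifs with h
  · subst h
    rw [tsum_eq_single (fun _ => k)]
    · rw [if_pos]
      · simp [walkWeight]
      · exact ⟨rfl, fun _ _ => rfl, fun t ht => by omega, fun _ => hk⟩
    · intro θ hθ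
      rw [if_neg]
      rintro ⟨-, h, -⟩
      exact hθ (funext fun t => h t (Nat.zero_le t))
  · rw [ENNReal.tsum_eq_zero]
    intro θ
    rw [if_neg]
    rintro ⟨h0, h1, -⟩
    exact h (h0.symm.trans (h1 0 le_rfl))

theorem isLWalk_cons {k j L a : ℕ} {θ : ℕ → ℕ} :
    IsLWalk k j (L + 1) (consEquiv (a, θ)) ↔
      a = k ∧ 1 ≤ k ∧ θ 0 ≤ k + 1 ∧ k ≤ θ 0 + 1 ∧ IsLWalk (θ 0) j L θ := by
  constructor
  · rintro ⟨h0, h1, h2, h3⟩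
    have ha : a = k := h0
    subst ha
    refine ⟨rfl, h3 0, (h2 0 (by omega)).1, (h2 0 (by omega)).2, rfl,
      fun t ht => h1 (t + 1) (by omega), fun t ht => h2 (t + 1) (by omega), fun t => h3 (t + 1)⟩
  · rintro ⟨rfl, h1, h2, h3, -, h5, h6, h7⟩
    refine ⟨rfl, fun t ht => ?_, fun t ht => ?_, fun t => ?_⟩
    · cases t with
      | zero => omega
      | succ t => exact h5 t (by omega)
    · cases t with
      | zero => exact ⟨h2, h3⟩
      | succ t => exact h6 t (by omega)
    · cases t with
      | zero => exact h1
      | succ t => exact h7 t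

/-- The weight of a step from `k` to `l`. -/
noncomputable def stepWeight (k l : ℕ) : ℝ := wseq k * wseq l / 12

theorem wseq_nonneg (k : ℕ) : 0 ≤ wseq k := by
  unfold wseq
  positivity

theorem stepWeight_nonneg (k l : ℕ) : 0 ≤ stepWeight k l :=
  div_nonneg (mul_nonneg (wseq_nonneg k) (wseq_nonneg l)) (by norm_num)

theorem walkWeight_cons (L a : ℕ) (θ : ℕ → ℕ) :
    walkWeight (L + 1) (consEquiv (a, θ)) =
      ENNReal.ofReal (stepWeight a (θ 0)) * walkWeight L θ := by
  unfold walkWeight stepWeight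
  rw [Finset.prod_range_succ', ENNReal.ofReal_div_of_pos (by norm_num)]
  simp only [consEquiv_zero, consEquiv_succ, zero_add]
  rw [← consEquiv_succ a θ 0, pow_succ, ENNReal.div_eq_inv_mul, ENNReal.div_eq_inv_mul,
    ENNReal.div_eq_inv_mul, ENNReal.mul_inv (by simp) (by simp)]
  norm_num
  ring

theorem walkSum_succ (j L m : ℕ) :
    walkSum j (L + 1) (m + 1) =
      ENNReal.ofReal (stepWeight (m + 1) m) * walkSum j L m +
      ENNReal.ofReal (stepWeight (m + 1) (m + 1)) * walkSum j L (m + 1) +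
      ENNReal.ofReal (stepWeight (m + 1) (m + 2)) * walkSum j L (m + 2) := by
  classical
  unfold walkSum
  rw [← consEquiv.tsum_eq, ENNReal.tsum_prod', tsum_eq_single (m + 1)]
  · rw [← ENNReal.tsum_mul_left, ← ENNReal.tsum_mul_left, ← ENNReal.tsum_mul_left,
      ← ENNReal.tsum_add, ← ENNReal.tsum_add]
    refine tsum_congr fun θ => ?_
    rw [walkWeight_cons]
    have key : ∀ l, IsLWalk l j L θ ↔ (l = θ 0 ∧ IsLWalk (θ 0) j L θ) := by
      intro l
      constructor
      · intro h
        have h0 : θ 0 = l := h.1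
        exact ⟨h0.symm, h0 ▸ h⟩
      · rintro ⟨rfl, h⟩
        exact h
    rw [key m, key (m + 1), key (m + 2)]
    by_cases hw : IsLWalk (θ 0) j L θ
    · by_cases h : θ 0 ≤ m + 2 ∧ m ≤ θ 0
      · have h' : θ 0 = m ∨ θ 0 = m + 1 ∨ θ 0 = m + 2 := by omega
        rw [if_pos (isLWalk_cons.2 ⟨rfl, by omega, h.1, by omega, hw⟩)]
        rcases h' with h' | h' | h' <;> rw [h'] at hw ⊢ <;> simp [hw]
      · rw [if_neg, if_neg, if_neg, if_neg]
        · simp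
        · rintro ⟨h', -⟩; omega
        · rintro ⟨h', -⟩; omega
        · rintro ⟨h', -⟩; omega
        · rw [isLWalk_cons]
          rintro ⟨-, -, h1, h2, -⟩
          omega
    · rw [if_neg]
      · simp [hw]
      · rw [isLWalk_cons]
        tauto
  · intro a ha
    rw [ENNReal.tsum_eq_zero]
    intro θ
    rw [if_neg]
    rw [isLWalk_cons]
    tauto

theorem Gfun_succ (m j : ℕ) :
    Gfun (m + 1) j = (if m + 1 = j then 1 else 0) +
      (ENNReal.ofReal (stepWeight (m + 1) m) * Gfun m j +
      ENNReal.ofReal (stepWeight (m + 1) (m + 1)) * Gfun (m + 1) j +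
      ENNReal.ofReal (stepWeight (m + 1) (m + 2)) * Gfun (m + 2) j) := by
  simp only [Gfun_eq_tsum_walkSum]
  conv_lhs => rw [tsum_eq_zero_add' ENNReal.summable, walkSum_length_zero (by omega)]
  congr 1
  simp only [walkSum_succ]
  rw [ENNReal.tsum_add, ENNReal.tsum_add, ENNReal.tsum_mul_left, ENNReal.tsum_mul_left,
    ENNReal.tsum_mul_left]

/-- The Green function is the minimal nonnegative solution of its renewal equation. -/
theorem Gfun_le_of_supersolution {j : ℕ} {g : ℕ → ℝ} (hg0 : ∀ k, 0 ≤ g k)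
    (hg : ∀ m, (if m + 1 = j then 1 else 0) + (stepWeight (m + 1) m * g m +
      stepWeight (m + 1) (m + 1) * g (m + 1) + stepWeight (m + 1) (m + 2) * g (m + 2)) ≤ g (m + 1))
    (k : ℕ) : Gfun k j ≤ ENNReal.ofReal (g k) := by
  have partialSum : ∀ n k, ∑ L ∈ Finset.range n, walkSum j L k ≤ ENNReal.ofReal (g k) := by
    intro n
    induction n with
    | zero => simp
    | succ n ih =>
      rintro (_ | m)
      · simp [walkSum_label_zero]
      · rw [Finset.sum_range_succ', walkSum_length_zero (by omega)]
        simp only [walkSum_succ, Finset.sum_add_distrib, ← Finset.mul_sum]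
        refine le_trans ?_ (ENNReal.ofReal_le_ofReal (hg m))
        have hs := stepWeight_nonneg (m + 1)
        have h1 := mul_nonneg (hs m) (hg0 m)
        have h2 := mul_nonneg (hs (m + 1)) (hg0 (m + 1))
        have h3 := mul_nonneg (hs (m + 2)) (hg0 (m + 2))
        conv_lhs => rw [add_comm]
        rw [ENNReal.ofReal_add (by split_ifs <;> norm_num) (by positivity),
          ENNReal.ofReal_add (by positivity) h3, ENNReal.ofReal_add h1 h2,
          ENNReal.ofReal_mul (hs m), ENNReal.ofReal_mul (hs (m + 1)),
          ENNReal.ofReal_mul (hs (m + 2))]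
        gcongr
        · split_ifs <;> simp
        · exact ih _
        · exact ih _
        · exact ih _
  rw [Gfun_eq_tsum_walkSum, ENNReal.tsum_eq_iSup_nat]
  exact iSup_le fun n => partialSum n k

/-- The solution of the homogeneous recurrence that vanishes at `0` and grows like `k ^ 4`. -/
noncomputable def growingSol (k : ℕ) : ℝ :=
  (72 * k + 888 * k ^ 2 + 2520 * k ^ 3 + 3255 * k ^ 4 + 2268 * k ^ 5 + 882 * k ^ 6 + 180 * k ^ 7 +
    15 * k ^ 8) / ((k + 1) * (k + 2)) ^ 2

/-- The solution of the homogeneous recurrence that decays like `k ^ (-3)`. -/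
noncomputable def decayingSol (k : ℕ) : ℝ := (2 * k + 3) / ((k + 1) * (k + 2)) ^ 2

theorem growingSol_nonneg (k : ℕ) : 0 ≤ growingSol k := by
  unfold growingSol
  positivity

theorem decayingSol_nonneg (k : ℕ) : 0 ≤ decayingSol k := by
  unfold decayingSol
  positivity

theorem wseq_succ_pos (m : ℕ) : 0 < wseq (m + 1) := by
  unfold wseq
  push_cast
  positivity

theorem growingSol_recurrence (m : ℕ) :
    growingSol (m + 1) =
      wseq (m + 1) ^ 2 / 12 * (growingSol m + growingSol (m + 1) + growingSol (m + 2)) := by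
  unfold growingSol wseq
  push_cast
  field_simp
  ring

theorem decayingSol_recurrence (m : ℕ) :
    decayingSol (m + 1) =
      wseq (m + 1) ^ 2 / 12 * (decayingSol m + decayingSol (m + 1) + decayingSol (m + 2)) := by
  unfold decayingSol wseq
  push_cast
  field_simp
  ring

theorem casoratian (k : ℕ) :
    growingSol (k + 1) * decayingSol k - growingSol k * decayingSol (k + 1) = 210 := by
  unfold growingSol decayingSol
  push_cast
  field_simp
  ring

/-- The closed form of the Green function. -/
noncomputable def green (j k : ℕ) : ℝ :=
  12 / 210 * ((if k ≤ j then growingSol k * decayingSol j else growingSol j * decayingSol k) /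
    (wseq j * wseq k))

theorem green_nonneg (j k : ℕ) : 0 ≤ green j k := by
  unfold green
  have := mul_nonneg (wseq_nonneg j) (wseq_nonneg k)
  have : 0 ≤ if k ≤ j then growingSol k * decayingSol j else growingSol j * decayingSol k := by
    split_ifs
    · exact mul_nonneg (growingSol_nonneg _) (decayingSol_nonneg _)
    · exact mul_nonneg (growingSol_nonneg _) (decayingSol_nonneg _)
  positivity

theorem wseq_mul_green (j k : ℕ) :
    wseq k * green j k = 12 / (210 * wseq j) *
      (if k ≤ j then growingSol k * decayingSol j else growingSol j * decayingSol k) := by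
  cases k with
  | zero => simp [wseq, growingSol]
  | succ m =>
    have := (wseq_succ_pos m).ne'
    unfold green
    rcases eq_or_ne (wseq j) 0 with h | h
    · simp [h]
    · field_simp

/-- The step operator on `g`, written in terms of `wseq * g`. -/
theorem step_eq (g : ℕ → ℝ) (m : ℕ) :
    stepWeight (m + 1) m * g m + stepWeight (m + 1) (m + 1) * g (m + 1) +
      stepWeight (m + 1) (m + 2) * g (m + 2) =
    wseq (m + 1) / 12 *
      (wseq m * g m + wseq (m + 1) * g (m + 1) + wseq (m + 2) * g (m + 2)) := by
  unfold stepWeight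
  ring

theorem green_renewal {j : ℕ} (hj : 1 ≤ j) (m : ℕ) :
    (if m + 1 = j then 1 else 0) + (stepWeight (m + 1) m * green j m +
      stepWeight (m + 1) (m + 1) * green j (m + 1) + stepWeight (m + 1) (m + 2) * green j (m + 2)) =
      green j (m + 1) := by
  rw [step_eq]
  have hw := wseq_succ_pos m
  have hwj : 0 < wseq j := by
    obtain ⟨i, rfl⟩ := Nat.exists_eq_add_of_le' hj
    exact wseq_succ_pos i
  apply mul_left_cancel₀ hw.ne'
  simp only [wseq_mul_green, mul_add]
  have hB : (12 / (210 * wseq j)) * (210 * wseq j) = 12 := by field_simp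
  set B := 12 / (210 * wseq j)
  have hu := growingSol_recurrence m
  have hv := decayingSol_recurrence m
  rcases lt_trichotomy (m + 1) j with h | h | h
  · rw [if_neg (by omega), if_pos (by omega), if_pos (by omega), if_pos (by omega)]
    linear_combination (-B * decayingSol j) * hu
  · subst h
    rw [if_pos rfl, if_pos (by omega), if_pos (by omega), if_neg (by omega)]
    have hc := casoratian (m + 1)
    linear_combination (-B * decayingSol (m + 1)) * hu - (wseq (m + 1) ^ 2 / 12) * B * hc
      - wseq (m + 1) / 12 * hB
  · have : (if m ≤ j then growingSol m * decayingSol j else growingSol j * decayingSol m) =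
        growingSol j * decayingSol m := by
      split_ifs
      · rw [show m = j by omega]
      · rfl
    rw [this, if_neg (by omega), if_neg (by omega), if_neg (by omega)]
    linear_combination (-B * growingSol j) * hv

theorem growingSol_lower (k : ℕ) (hk : 1 ≤ k) : (k : ℝ) ^ 4 / 3 ≤ growingSol k := by
  have hk' : (1 : ℝ) ≤ k := by exact_mod_cast hk
  unfold growingSol
  rw [le_div_iff₀ (by positivity)]
  have h : ((k : ℝ) + 1) * (k + 2) ≤ 6 * k ^ 2 := by nlinarith
  have h2 : (((k : ℝ) + 1) * (k + 2)) ^ 2 ≤ (6 * k ^ 2) ^ 2 := by gcongr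
  calc (k : ℝ) ^ 4 / 3 * ((k + 1) * (k + 2)) ^ 2 ≤ (k : ℝ) ^ 4 / 3 * (6 * k ^ 2) ^ 2 := by gcongr
    _ = 12 * (k : ℝ) ^ 8 := by ring
    _ ≤ 15 * (k : ℝ) ^ 8 := by gcongr; norm_num
    _ ≤ _ := le_add_of_nonneg_left (by positivity)

theorem growingSol_upper (k : ℕ) (hk : 1 ≤ k) : growingSol k ≤ 10080 * (k : ℝ) ^ 4 := by
  have hk' : (1 : ℝ) ≤ k := by exact_mod_cast hk
  unfold growingSol
  rw [div_le_iff₀ (by positivity)]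
  have hp : ∀ i ≤ 8, (k : ℝ) ^ i ≤ k ^ 8 := fun i hi => pow_le_pow_right₀ hk' hi
  have h1 := hp 1 (by norm_num)
  have h2 := hp 2 (by norm_num)
  have h3 := hp 3 (by norm_num)
  have h4 := hp 4 (by norm_num)
  have h5 := hp 5 (by norm_num)
  have h6 := hp 6 (by norm_num)
  have h7 := hp 7 (by norm_num)
  rw [pow_one] at h1
  have h : (k : ℝ) ^ 2 ≤ (k + 1) * (k + 2) := by nlinarith
  calc _ ≤ 10080 * (k : ℝ) ^ 8 := by linarith
    _ = 10080 * (k : ℝ) ^ 4 * (k ^ 2) ^ 2 := by ring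
    _ ≤ _ := by gcongr

theorem decayingSol_lower (k : ℕ) (hk : 1 ≤ k) : 1 / (18 * (k : ℝ) ^ 3) ≤ decayingSol k := by
  have hk' : (1 : ℝ) ≤ k := by exact_mod_cast hk
  unfold decayingSol
  have h : ((k : ℝ) + 1) * (k + 2) ≤ 6 * k ^ 2 := by nlinarith
  calc 1 / (18 * (k : ℝ) ^ 3) = (2 * k) / (6 * k ^ 2) ^ 2 := by field_simp; norm_num
    _ ≤ _ := by gcongr; linarith

theorem decayingSol_upper (k : ℕ) (hk : 1 ≤ k) : decayingSol k ≤ 5 / (k : ℝ) ^ 3 := by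
  have hk' : (1 : ℝ) ≤ k := by exact_mod_cast hk
  unfold decayingSol
  have h : (k : ℝ) ^ 2 ≤ (k + 1) * (k + 2) := by nlinarith
  calc _ ≤ (5 * k) / ((k : ℝ) ^ 2) ^ 2 := by gcongr; linarith
    _ = _ := by field_simp

theorem wseq_lower (k : ℕ) (hk : 1 ≤ k) : 4 / 3 ≤ wseq k := by
  have hk' : (1 : ℝ) ≤ k := by exact_mod_cast hk
  unfold wseq
  rw [le_div_iff₀ (by positivity)]
  nlinarith

theorem wseq_upper (k : ℕ) : wseq k ≤ 2 := by
  unfold wseq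
  rw [div_le_iff₀ (by positivity)]
  nlinarith

/-- A bounded solution of the homogeneous renewal equation vanishes. -/
theorem eq_zero_of_harmonic_of_bounded {d : ℕ → ℝ} {M : ℝ} (hM : ∀ k, wseq k * d k ≤ M)
    (h0 : ∀ k, 0 ≤ d k)
    (hd : ∀ m, d (m + 1) = stepWeight (m + 1) m * d m +
      stepWeight (m + 1) (m + 1) * d (m + 1) + stepWeight (m + 1) (m + 2) * d (m + 2))
    {k : ℕ} (hk : 1 ≤ k) : d k = 0 := by
  have hu1 : growingSol 1 = 280 := by norm_num [growingSol]
  have hprop : ∀ k, wseq k * d k = wseq 1 * d 1 / 280 * growingSol k ∧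
      wseq (k + 1) * d (k + 1) = wseq 1 * d 1 / 280 * growingSol (k + 1) := by
    intro k
    induction k with
    | zero =>
      refine ⟨by simp [wseq, growingSol], ?_⟩
      rw [zero_add, hu1]
      ring
    | succ m ih =>
      refine ⟨ih.2, ?_⟩
      have hw := wseq_succ_pos m
      have h1 := hd m
      rw [step_eq] at h1
      have hu := growingSol_recurrence m
      apply mul_left_cancel₀ (pow_pos hw 2).ne'
      linear_combination (-12 * wseq (m + 1)) * h1 + 12 * (wseq 1 * d 1 / 280) * hu
        - wseq (m + 1) ^ 2 * ih.1 + (12 - wseq (m + 1) ^ 2) * ih.2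
  have hc0 : wseq 1 * d 1 / 280 = 0 := by
    by_contra hne
    have hpos : 0 < wseq 1 * d 1 / 280 :=
      lt_of_le_of_ne (div_nonneg (mul_nonneg (wseq_nonneg 1) (h0 1)) (by norm_num)) (Ne.symm hne)
    obtain ⟨n, hn⟩ := exists_nat_gt (3 * M / (wseq 1 * d 1 / 280))
    have hg := growingSol_lower (n + 1) (by omega)
    have hlow : (n : ℝ) ≤ ((n + 1 : ℕ) : ℝ) ^ 4 := by
      have : n ≤ (n + 1) ^ 4 := (Nat.le_succ n).trans (Nat.le_self_pow (by norm_num) _)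
      exact_mod_cast this
    have hle := hM (n + 1)
    rw [(hprop n).2] at hle
    rw [div_lt_iff₀ hpos] at hn
    have := mul_le_mul_of_nonneg_left (hlow.trans (by linarith : _ ≤ 3 * growingSol (n + 1)))
      hpos.le
    linarith
  have hk0 := (hprop k).1
  rw [hc0, zero_mul] at hk0
  obtain ⟨m, rfl⟩ := Nat.exists_eq_add_of_le' hk
  exact (mul_eq_zero.1 hk0).resolve_left (wseq_succ_pos m).ne'

theorem wseq_mul_green_bounded (j : ℕ) : ∃ M, ∀ k, wseq k * green j k ≤ M := by
  have hw := wseq_nonneg j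
  have hv3 : ∀ k, decayingSol k ≤ 3 := by
    intro k
    unfold decayingSol
    rw [div_le_iff₀ (by positivity)]
    have hk : (0 : ℝ) ≤ k := k.cast_nonneg
    have h : (2 * k + 3 : ℝ) ≤ 3 * ((k + 1) * (k + 2)) := by nlinarith
    have h1 : (1 : ℝ) ≤ (k + 1) * (k + 2) := by nlinarith
    nlinarith
  refine ⟨12 / (210 * wseq j) * (10080 * (j : ℝ) ^ 4 * 3), fun k => ?_⟩
  rw [wseq_mul_green]
  have huj : ∀ i ≤ j, growingSol i ≤ 10080 * (j : ℝ) ^ 4 := by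
    intro i hi
    rcases Nat.eq_zero_or_pos i with rfl | hpos
    · simp only [growingSol]
      norm_num
    · refine (growingSol_upper i hpos).trans ?_
      gcongr
  gcongr
  split_ifs with h
  · exact mul_le_mul (huj k h) (hv3 j) (decayingSol_nonneg _) (by positivity)
  · exact mul_le_mul (huj j le_rfl) (hv3 k) (decayingSol_nonneg _) (by positivity)

theorem Gfun_eq_green {j k : ℕ} (hj : 1 ≤ j) (hk : 1 ≤ k) :
    Gfun k j = ENNReal.ofReal (green j k) := by
  have hle : ∀ k, Gfun k j ≤ ENNReal.ofReal (green j k) :=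
    Gfun_le_of_supersolution (green_nonneg j) fun m => (green_renewal hj m).le
  have hfin : ∀ k, Gfun k j ≠ ⊤ := fun k => ne_top_of_le_ne_top ENNReal.ofReal_ne_top (hle k)
  have hleR : ∀ k, (Gfun k j).toReal ≤ green j k := fun k =>
    ENNReal.toReal_le_of_le_ofReal (green_nonneg j k) (hle k)
  have hG : ∀ m, (Gfun (m + 1) j).toReal = (if m + 1 = j then 1 else 0) +
      (stepWeight (m + 1) m * (Gfun m j).toReal +
      stepWeight (m + 1) (m + 1) * (Gfun (m + 1) j).toReal +
      stepWeight (m + 1) (m + 2) * (Gfun (m + 2) j).toReal) := by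
    intro m
    have hne : ∀ l, ENNReal.ofReal (stepWeight (m + 1) l) * Gfun l j ≠ ⊤ := fun l =>
      ENNReal.mul_ne_top ENNReal.ofReal_ne_top (hfin l)
    have htr : ∀ l, (ENNReal.ofReal (stepWeight (m + 1) l) * Gfun l j).toReal =
        stepWeight (m + 1) l * (Gfun l j).toReal := fun l => by
      rw [ENNReal.toReal_mul, ENNReal.toReal_ofReal (stepWeight_nonneg _ _)]
    conv_lhs => rw [Gfun_succ]
    rw [ENNReal.toReal_add (by split_ifs <;> simp)
      (ENNReal.add_ne_top.2 ⟨ENNReal.add_ne_top.2 ⟨hne _, hne _⟩, hne _⟩),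
      ENNReal.toReal_add (ENNReal.add_ne_top.2 ⟨hne _, hne _⟩) (hne _),
      ENNReal.toReal_add (hne _) (hne _), htr, htr, htr]
    congr 1
    split_ifs <;> simp
  obtain ⟨M, hM⟩ := wseq_mul_green_bounded j
  have hd := eq_zero_of_harmonic_of_bounded (d := fun k => green j k - (Gfun k j).toReal) (M := M)
    (fun k => le_trans (mul_le_mul_of_nonneg_left (sub_le_self _ ENNReal.toReal_nonneg)
      (wseq_nonneg k)) (hM k))
    (fun k => sub_nonneg.2 (hleR k))
    (fun m => by
      have h1 := hG m
      have h2 := green_renewal hj m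
      linear_combination -h2 - h1) hk
  rw [sub_eq_zero.1 hd, ENNReal.ofReal_toReal (hfin k)]

theorem stmt13 :
    ∃ c C : ℝ, 0 < c ∧ c ≤ C ∧
      ∀ k j : ℕ, 1 ≤ k → k < j →
        ENNReal.ofReal (c * (k : ℝ) ^ 4 / (j : ℝ) ^ 3) ≤ Gfun k j ∧
        Gfun k j ≤ ENNReal.ofReal (C * (k : ℝ) ^ 4 / (j : ℝ) ^ 3) := by
  refine ⟨12 / 210 * (1 / 3 * (1 / 18) / (2 * 2)),
    12 / 210 * (10080 * 5 / (4 / 3 * (4 / 3))), by norm_num, by norm_num, fun k j hk hkj => ?_⟩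
  have hj : 1 ≤ j := by omega
  rw [Gfun_eq_green hj hk, green, if_pos hkj.le]
  have hk0 : (0 : ℝ) < k := by exact_mod_cast hk
  have hj0 : (0 : ℝ) < j := by exact_mod_cast hj
  have hwk := wseq_lower k hk
  have hwj := wseq_lower j hj
  have hwk0 : 0 < wseq k := by linarith
  have hwj0 : 0 < wseq j := by linarith
  have hu := growingSol_nonneg k
  have hv := decayingSol_nonneg j
  constructor <;> apply ENNReal.ofReal_le_ofReal
  · calc _ = 12 / 210 * ((k : ℝ) ^ 4 / 3 * (1 / (18 * (j : ℝ) ^ 3)) / (2 * 2)) := by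
          field_simp
      _ ≤ _ := by
          have h1 := growingSol_lower k hk
          have h2 := decayingSol_lower j hj
          have h3 := wseq_upper k
          have h4 := wseq_upper j
          gcongr
  · calc _ ≤ 12 / 210 * (10080 * (k : ℝ) ^ 4 * (5 / (j : ℝ) ^ 3) / (4 / 3 * (4 / 3))) := by
          have h1 := growingSol_upper k hk
          have h2 := decayingSol_upper j hj
          gcongr
      _ = _ := by
          field_simp
end

section
/- Define ψ₊(j) = j(j+1)(j+2)(j+3) and ψ₋(j) = j(j+1)(j+2)(j+3)·∑_{k=j}^∞ 1/(k(k+1)²(k+2)²(k+3)²(k+4)) for integers j ≥ 1. Then for every j ≥ 2, both ψ = ψ₊ and ψ = ψ₋ satisfy ψ(j+1) + ψ(j-1) - 2ψ(j) = (12/(j(j+3)))·ψ(j). Moreover there exist constants 0 < c ≤ C such that c/j³ ≤ ψ₋(j) ≤ C/j³ for all j ≥ 1. -/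
/-- `ψ₊(j) = j(j+1)(j+2)(j+3)`. -/
noncomputable def psiPlus (j : ℕ) : ℝ := (j : ℝ) * (j + 1) * (j + 2) * (j + 3)

/-- `ψ₋(j) = j(j+1)(j+2)(j+3) ∑_{k≥j} 1/(k(k+1)²(k+2)²(k+3)²(k+4))`. -/
noncomputable def psiMinus (j : ℕ) : ℝ :=
  (j : ℝ) * (j + 1) * (j + 2) * (j + 3) *
    ∑' i : ℕ, 1 / (((j + i : ℕ) : ℝ) * ((j + i : ℕ) + 1) ^ 2 *
      ((j + i : ℕ) + 2) ^ 2 * ((j + i : ℕ) + 3) ^ 2 * ((j + i : ℕ) + 4))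

/-- The summand `1/(k(k+1)²(k+2)²(k+3)²(k+4))` of the series defining `psiMinus`. -/
noncomputable def psiTerm (k : ℕ) : ℝ :=
  1 / ((k : ℝ) * (k + 1) ^ 2 * (k + 2) ^ 2 * (k + 3) ^ 2 * (k + 4))

theorem psiMinus_eq_psiPlus_mul_tsum (j : ℕ) :
    psiMinus j = psiPlus j * ∑' i : ℕ, psiTerm (j + i) := rfl

theorem psiTerm_nonneg (k : ℕ) : 0 ≤ psiTerm k := by
  unfold psiTerm
  positivity

theorem psiTerm_le {j k : ℕ} (hj : 1 ≤ j) (hjk : j ≤ k) :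
    psiTerm k ≤ 1 / (j : ℝ) ^ 6 * (1 / (k : ℝ) - 1 / (k + 1)) := by
  have hj0 : (0 : ℝ) < j := by exact_mod_cast hj
  have hjk' : (j : ℝ) ≤ k := by exact_mod_cast hjk
  have hk0 : (0 : ℝ) < k := hj0.trans_le hjk'
  have h : 1 / (j : ℝ) ^ 6 * (1 / (k : ℝ) - 1 / (k + 1)) =
      1 / ((k : ℝ) * ((k + 1) * j) * j ^ 2 * j ^ 2 * j) := by
    field_simp
    ring
  rw [h]
  unfold psiTerm
  rw [sq ((k : ℝ) + 1)]
  gcongr <;> linarith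

theorem sum_range_psiTerm_le {j : ℕ} (hj : 1 ≤ j) (n : ℕ) :
    ∑ i ∈ Finset.range n, psiTerm (j + i) ≤ 1 / (j : ℝ) ^ 7 := by
  have hj0 : (0 : ℝ) < j := by exact_mod_cast hj
  calc ∑ i ∈ Finset.range n, psiTerm (j + i)
      ≤ 1 / (j : ℝ) ^ 6 * (1 / (j : ℝ) - 1 / ((j : ℝ) + n)) := by
        induction n with
        | zero => simp
        | succ n ih =>
          have h := psiTerm_le hj (Nat.le_add_right j n)
          rw [Finset.sum_range_succ]
          push_cast at h ⊢
          rw [← add_assoc]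
          linarith
    _ ≤ 1 / (j : ℝ) ^ 6 * (1 / (j : ℝ)) := by
        gcongr
        exact sub_le_self _ (by positivity)
    _ = 1 / (j : ℝ) ^ 7 := by
        field_simp

theorem summable_psiTerm {j : ℕ} (hj : 1 ≤ j) : Summable fun i => psiTerm (j + i) :=
  summable_of_sum_range_le (fun _ => psiTerm_nonneg _) (sum_range_psiTerm_le hj)

theorem tsum_psiTerm_le {j : ℕ} (hj : 1 ≤ j) :
    ∑' i, psiTerm (j + i) ≤ 1 / (j : ℝ) ^ 7 :=
  Real.tsum_le_of_sum_range_le (fun _ => psiTerm_nonneg _) (sum_range_psiTerm_le hj)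

theorem le_tsum_psiTerm {j : ℕ} (hj : 1 ≤ j) :
    1 / (6 ^ 8 * (j : ℝ) ^ 7) ≤ ∑' i, psiTerm (j + i) := by
  have hj1 : (1 : ℝ) ≤ j := by exact_mod_cast hj
  have hterm : ∀ i ∈ Finset.range j, 1 / (6 * (j : ℝ)) ^ 8 ≤ psiTerm (j + i) := by
    intro i hi
    have hij : (i : ℝ) ≤ j := by exact_mod_cast (Finset.mem_range.mp hi).le
    have h : (6 * (j : ℝ)) ^ 8 = 6 * (j : ℝ) * (6 * (j : ℝ)) ^ 2 * (6 * (j : ℝ)) ^ 2 *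
      (6 * (j : ℝ)) ^ 2 * (6 * (j : ℝ)) := by ring
    rw [h]
    unfold psiTerm
    push_cast
    gcongr <;> linarith
  calc 1 / (6 ^ 8 * (j : ℝ) ^ 7) = j * (1 / (6 * (j : ℝ)) ^ 8) := by
        field_simp
    _ ≤ ∑ i ∈ Finset.range j, psiTerm (j + i) := by
        simpa using Finset.card_nsmul_le_sum _ _ _ hterm
    _ ≤ ∑' i, psiTerm (j + i) :=
        (summable_psiTerm hj).sum_le_tsum _ fun _ _ => psiTerm_nonneg _

theorem tsum_psiTerm_eq_add {j : ℕ} (hj : 1 ≤ j) :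
    ∑' i, psiTerm (j + i) = psiTerm j + ∑' i, psiTerm (j + 1 + i) := by
  rw [(summable_psiTerm hj).tsum_eq_zero_add]
  simp only [add_zero, add_assoc, add_comm 1]

theorem stmt15 :
    (∀ j : ℕ, 2 ≤ j →
      (psiPlus (j + 1) + psiPlus (j - 1) - 2 * psiPlus j =
        (12 / ((j : ℝ) * (j + 3))) * psiPlus j) ∧
      (psiMinus (j + 1) + psiMinus (j - 1) - 2 * psiMinus j =
        (12 / ((j : ℝ) * (j + 3))) * psiMinus j)) ∧
    ∃ c C : ℝ, 0 < c ∧ c ≤ C ∧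
      ∀ j : ℕ, 1 ≤ j → c / (j : ℝ) ^ 3 ≤ psiMinus j ∧ psiMinus j ≤ C / (j : ℝ) ^ 3 := by
  refine ⟨fun j hj => ?_, 1 / 6 ^ 8, 24, by norm_num, by norm_num, fun j hj => ?_⟩
  · obtain ⟨m, rfl⟩ : ∃ m, j = m + 1 := ⟨j - 1, by omega⟩
    have hm : 1 ≤ m := by omega
    have hm0 : (0 : ℝ) < m := by exact_mod_cast hm
    rw [Nat.add_sub_cancel]
    constructor
    · unfold psiPlus
      push_cast
      field_simp
      ring
    · simp only [psiMinus_eq_psiPlus_mul_tsum]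
      rw [tsum_psiTerm_eq_add hm, tsum_psiTerm_eq_add (show 1 ≤ m + 1 by omega)]
      generalize ∑' i, psiTerm (m + 1 + 1 + i) = S
      unfold psiPlus psiTerm
      push_cast
      field_simp
      ring
  · have hj1 : (1 : ℝ) ≤ j := by exact_mod_cast hj
    have hlow : (j : ℝ) ^ 4 ≤ psiPlus j := by
      calc (j : ℝ) ^ 4 = j * j * j * j := by ring
        _ ≤ psiPlus j := by
          unfold psiPlus
          gcongr <;> linarith
    have hupp : psiPlus j ≤ 24 * (j : ℝ) ^ 4 := by
      calc psiPlus j ≤ (j : ℝ) * (2 * j) * (3 * j) * (4 * j) := by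
            unfold psiPlus
            gcongr <;> linarith
        _ = 24 * (j : ℝ) ^ 4 := by ring
    rw [psiMinus_eq_psiPlus_mul_tsum]
    constructor
    · calc 1 / 6 ^ 8 / (j : ℝ) ^ 3 = (j : ℝ) ^ 4 * (1 / (6 ^ 8 * (j : ℝ) ^ 7)) := by
            field_simp
        _ ≤ psiPlus j * ∑' i, psiTerm (j + i) := by
            gcongr
            · exact le_trans (by positivity) hlow
            · exact le_tsum_psiTerm hj
    · calc psiPlus j * ∑' i, psiTerm (j + i) ≤ 24 * (j : ℝ) ^ 4 * (1 / (j : ℝ) ^ 7) := by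
            gcongr
            · exact tsum_nonneg fun _ => psiTerm_nonneg _
            · exact tsum_psiTerm_le hj
        _ = 24 / (j : ℝ) ^ 3 := by
            field_simp
end

section
/- Let w : ℕ → ℝ be defined by w(0) = 0 and w(k) = 2k(k+3)/((k+1)(k+2)) for k ≥ 1. Then for every integer k ≥ 2: 12/(k(k+3)) ≤ 3·(4/w(k)² - 1) ≤ 12/((k-1)(k+2)). -/
/-- Closed form of the coefficient `3 * (4 / w(k)² - 1)` in terms of `k * (k + 3)`. -/
theorem three_mul_four_div_wseq_sq_sub_one {k : ℕ} (hk : k ≠ 0) :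
    3 * (4 / (wseq k) ^ 2 - 1) =
      12 * ((k : ℝ) * (k + 3) + 1) / ((k : ℝ) * (k + 3)) ^ 2 := by
  have hk' : (k : ℝ) ≠ 0 := by exact_mod_cast hk
  unfold wseq
  field_simp
  ring

theorem stmt16 (k : ℕ) (hk : 2 ≤ k) :
    12 / ((k : ℝ) * (k + 3)) ≤ 3 * (4 / (wseq k) ^ 2 - 1) ∧
    3 * (4 / (wseq k) ^ 2 - 1) ≤ 12 / (((k : ℝ) - 1) * ((k : ℝ) + 2)) := by
  have hk2 : (2 : ℝ) ≤ k := by exact_mod_cast hk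
  have ht : 0 < (k : ℝ) * (k + 3) := by positivity
  have hs : 0 < ((k : ℝ) - 1) * (k + 2) := mul_pos (by linarith) (by linarith)
  rw [three_mul_four_div_wseq_sq_sub_one (by lia)]
  constructor
  · rw [div_le_div_iff₀ ht (by positivity)]
    nlinarith
  · rw [div_le_div_iff₀ (by positivity) hs]
    nlinarith [mul_pos ht (by linarith : (0 : ℝ) < k)]
end
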